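/- For all a, b, x ∈ ℤ and A, B ∈ ℤ*: (A, a, 0, b, B) ~ (A, a-x, 0, b+x, B) and (A, a, 0, b, B) ~ (A, 0, 0, a+b, B), where (A, a, 0, b, B) denotes the concatenation of A, the one-term sequences (a), (0), (b), and B. -/

import Mathlib

/-- `Y` is a blowing-up of the finite integer sequence `X`. -/
inductive SeqBlowup : List ℤ → List ℤ → Prop
  | empty : SeqBlowup [] [-1]
  | left (x : ℤ) (l : List ℤ) : SeqBlowup (x :: l) (-1 :: (x - 1) :: l)
  | mid (A B : List ℤ) (a b : ℤ) :
      SeqBlowup (A ++ a :: b :: B) (A ++ (a - 1) :: -1 :: (b - 1) :: B)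
  | right (l : List ℤ) (x : ℤ) : SeqBlowup (l ++ [x]) (l ++ [x - 1, -1])

/-- Two sequences are equivalent if one is obtained from the other by a finite
sequence of blowings-up and blowings-down. -/
def SeqEquiv (X Y : List ℤ) : Prop := Relation.EqvGen SeqBlowup X Y

/-- Blowing up on one side of a `0` and blowing down on the other moves one unit across it. -/
lemma seqEquiv_sub_one_zero_add_one (a b : ℤ) (A B : List ℤ) :
    SeqEquiv (A ++ a :: 0 :: b :: B) (A ++ (a - 1) :: 0 :: (b + 1) :: B) := by
  have h := SeqBlowup.mid (A ++ [a - 1]) B 0 (b + 1)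
  simp only [List.append_assoc, List.singleton_append, add_sub_cancel_right] at h
  exact .trans _ _ _ (.rel _ _ (.mid A (b :: B) a 0)) (.symm _ _ (.rel _ _ h))

lemma seqEquiv_sub_zero_add (a b x : ℤ) (A B : List ℤ) :
    SeqEquiv (A ++ a :: 0 :: b :: B) (A ++ (a - x) :: 0 :: (b + x) :: B) := by
  induction x using Int.induction_on with
  | zero => simpa only [sub_zero, add_zero] using .refl _
  | succ n ih =>
    have h := seqEquiv_sub_one_zero_add_one (a - n) (b + n) A B
    rw [sub_sub, add_assoc] at h
    exact .trans _ _ _ ih h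
  | pred n ih =>
    have h := seqEquiv_sub_one_zero_add_one (a - (-n - 1)) (b + (-n - 1)) A B
    rw [sub_sub, add_assoc, sub_add_cancel] at h
    exact .trans _ _ _ ih (.symm _ _ h)


/-- **Lemma.** `(A, a, 0, b, B) ~ (A, a-x, 0, b+x, B) ~ (A, 0, 0, a+b, B)`. -/
theorem seqEquiv_shift_around_zero (a b x : ℤ) (A B : List ℤ) :
    SeqEquiv (A ++ a :: 0 :: b :: B) (A ++ (a - x) :: 0 :: (b + x) :: B) ∧
    SeqEquiv (A ++ a :: 0 :: b :: B) (A ++ 0 :: 0 :: (a + b) :: B) := by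
  have h := seqEquiv_sub_zero_add a b a A B
  rw [sub_self, add_comm b a] at h
  exact ⟨seqEquiv_sub_zero_add a b x A B, h⟩
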